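/- Let Z be a boundedly-finite ultrametric space, s a positive real number, and C an s-connected amenable metric space. If f : C×Z → X is a coarse isomorphism onto a shift-homogeneous metric space X, then ω_f(s) ∈ ss(X), and for each ε ≥ ω_f(s) there exist n ∈ ℕ and a function f_ε : Z → X/ε all of whose fibers have exactly n elements, such that q_ε ∘ f = f_ε ∘ pr, where pr : C×Z → Z is the projection and q_ε : X → X/ε sends x to X_ε(x). -/

import Mathlib

open scoped ENNReal symmDiff

noncomputable section

/-- The supremum in `ℕ∞` of a set of natural numbers. -/
def natSup (s : Set ℕ) : ℕ∞ := sSup ((↑) '' s : Set ℕ∞)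

/-- The `ε`-connected component of a point `x`: all points linkable to `x` by a chain with
consecutive distances `≤ ε` (for `ε = ∞` this is the whole space). -/
def comp (X : Type*) [MetricSpace X] (ε : ℝ≥0∞) (x : X) : Set X :=
  {y | Relation.ReflTransGen (fun a b => edist a b ≤ ε) x y}

/-- `ss X` is the set of `ε ∈ [0,∞]` such that for every finite `δ ≥ ε` and every point `x` the
set `{X_ε(y) : y ∈ X_δ(x)}` of `ε`-components of points of `X_δ(x)` is finite. -/
def ssSet (X : Type*) [MetricSpace X] : Set ℝ≥0∞ :=
  {ε | ∀ δ : ℝ≥0∞, δ ≠ ⊤ → ε ≤ δ → ∀ x : X, ((comp X ε) '' (comp X δ x)).Finite}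

/-- The factorizing step `s(X) = inf ss(X)`. -/
def sStep (X : Type*) [MetricSpace X] : ℝ≥0∞ := sInf (ssSet X)

/-- A metric space is boundedly-finite if every bounded subset is finite. -/
def BoundedlyFinite (X : Type*) [MetricSpace X] : Prop :=
  ∀ s : Set X, Bornology.IsBounded s → s.Finite

/-- A metric space is homogeneous if for any two points there is a bijective self-isometry
moving one to the other. -/
def Homogeneous (X : Type*) [MetricSpace X] : Prop :=
  ∀ x y : X, ∃ f : X ≃ᵢ X, f x = y

/-- A subset `C` is large scale connected if any two of its points can be linked by an
`ε`-chain for a common finite `ε`. -/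
def IsLSCSet {X : Type*} [MetricSpace X] (C : Set X) : Prop :=
  ∃ ε : ℝ≥0∞, ε ≠ ⊤ ∧ ∀ x ∈ C, ∀ y ∈ C, y ∈ comp X ε x

/-- A metric space is large scale connected if it coincides with an `ε`-connected component
for some finite `ε`. -/
def LargeScaleConnected (X : Type*) [MetricSpace X] : Prop :=
  ∃ ε : ℝ≥0∞, ε ≠ ⊤ ∧ ∀ x y : X, y ∈ comp X ε x

/-- A metric space is shift-homogeneous if any point can be moved to any other point by a
bijective self-isometry whose displacement is bounded on each large scale connected subset. -/
def ShiftHomogeneous (X : Type*) [MetricSpace X] : Prop :=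
  ∀ x y : X, ∃ f : X ≃ᵢ X, f x = y ∧
    ∀ C : Set X, IsLSCSet C → ∃ M : ℝ, ∀ c ∈ C, dist (f c) c ≤ M

/-- The oscillation `ω_f(δ) = sup {d (f x) (f x') : d x x' ≤ δ}` of a map, in `[0,∞]`. -/
def osc {X Y : Type*} [MetricSpace X] [MetricSpace Y] (f : X → Y) (δ : ℝ≥0∞) : ℝ≥0∞ :=
  ⨆ (x : X) (x' : X) (_ : edist x x' ≤ δ), edist (f x) (f x')

/-- A map between metric spaces is coarse if its oscillation at each finite `δ` is finite. -/
def CoarseMapM {X Y : Type*} [MetricSpace X] [MetricSpace Y] (f : X → Y) : Prop :=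
  ∀ δ : ℝ≥0∞, δ ≠ ⊤ → osc f δ ≠ ⊤

/-- Two metric spaces are coarsely isomorphic if there is a bijection between them which is
coarse in both directions. -/
def CoarselyIsomorphic (X Y : Type*) [MetricSpace X] [MetricSpace Y] : Prop :=
  ∃ f : X ≃ Y, CoarseMapM ⇑f ∧ CoarseMapM ⇑f.symm

/-- Two metric spaces are coarsely equivalent if there are coarse maps in both directions whose
compositions are within finite distance of the identities. -/
def CoarselyEquivalent (X Y : Type*) [MetricSpace X] [MetricSpace Y] : Prop :=
  ∃ f : X → Y, CoarseMapM f ∧ ∃ g : Y → X, CoarseMapM g ∧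
    (∃ M : ℝ, ∀ x : X, dist x (g (f x)) ≤ M) ∧ (∃ M : ℝ, ∀ y : Y, dist y (f (g y)) ≤ M)

/-- A metric on a group is left-invariant if left translations are isometries. -/
def LeftInvariantMetric (G : Type*) [Group G] [MetricSpace G] : Prop :=
  ∀ g x y : G, dist (g * x) (g * y) = dist x y

/-- A metric on a countable space is proper if all closed balls are finite. -/
def ProperMetric (X : Type*) [MetricSpace X] : Prop :=
  ∀ (x : X) (r : ℝ), (Metric.closedBall x r).Finite

/-- A metric space is amenable if for every `c > 1` and finite `ε > 0` there is a nonempty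
finite set `F` whose closed `ε`-neighbourhood `O_ε(F)` is finite of cardinality `≤ c * |F|`. -/
def AmenableSpace (X : Type*) [MetricSpace X] : Prop :=
  ∀ c : ℝ, 1 < c → ∀ ε : ℝ, 0 < ε → ∃ F : Finset X, F.Nonempty ∧
    {x : X | ∃ y ∈ F, dist x y ≤ ε}.Finite ∧
    ({x : X | ∃ y ∈ F, dist x y ≤ ε}.ncard : ℝ) ≤ c * F.card

section Components

variable {X Y : Type*} [MetricSpace X] [MetricSpace Y] {ε δ : ℝ≥0∞}

theorem mem_comp_self (x : X) : x ∈ comp X ε x := Relation.ReflTransGen.refl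

theorem mem_comp_symm {x y : X} (h : y ∈ comp X ε x) : x ∈ comp X ε y :=
  haveI : Std.Symm (fun a b : X => edist a b ≤ ε) := ⟨fun a b hab => by rwa [edist_comm]⟩
  Relation.ReflTransGen.stdSymm.symm _ _ h

theorem mem_comp_trans {x y z : X} (hxy : y ∈ comp X ε x) (hyz : z ∈ comp X ε y) :
    z ∈ comp X ε x :=
  Relation.ReflTransGen.trans hxy hyz

theorem comp_eq_comp_iff {x y : X} : comp X ε x = comp X ε y ↔ x ∈ comp X ε y :=
  ⟨fun h => h ▸ mem_comp_self x, fun h => Set.ext fun _ =>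
    ⟨fun hz => mem_comp_trans h hz, fun hz => mem_comp_trans (mem_comp_symm h) hz⟩⟩

theorem map_mem_comp {f : X → Y} (hf : ∀ a b, edist a b ≤ δ → edist (f a) (f b) ≤ ε)
    {x y : X} (h : y ∈ comp X δ x) : f y ∈ comp Y ε (f x) :=
  Relation.ReflTransGen.lift f hf _ _ h

theorem edist_map_le_osc (f : X → Y) {a b : X} (h : edist a b ≤ δ) :
    edist (f a) (f b) ≤ osc f δ :=
  le_iSup_of_le a (le_iSup_of_le b (le_iSup_of_le h le_rfl))

theorem isLSCSet_comp (hε : ε ≠ ⊤) (x : X) : IsLSCSet (comp X ε x) :=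
  ⟨ε, hε, fun _ ha _ hb => mem_comp_trans (mem_comp_symm ha) hb⟩

/-- In an ultrametric space, `ε`-components are contained in balls of radius `ε`. -/
theorem edist_le_of_mem_comp (hX : ∀ x y z : X, dist x z ≤ max (dist x y) (dist y z))
    {x y : X} (h : y ∈ comp X ε x) : edist x y ≤ ε := by
  induction h with
  | refl => simp
  | @tail a b _ hab ih =>
    have h3 : edist x b ≤ max (edist x a) (edist a b) := by
      simp only [edist_dist, ← ENNReal.ofReal_max]
      exact ENNReal.ofReal_le_ofReal (hX x a b)
    exact h3.trans (max_le ih hab)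

end Components

/-- If `C` is amenable and an injective self-map of `C × Z` sends `C × A` into `C × B` and moves
the first coordinate of points of `C × A` by a bounded distance, then `|A| ≤ |B|`. -/
theorem AmenableSpace.card_le_of_injective {C Z : Type*} [MetricSpace C] (hC : AmenableSpace C) {A B : Finset Z}
    {h : C × Z → C × Z} (hinj : Function.Injective h)
    (hAB : ∀ p : C × Z, p.2 ∈ A → (h p).2 ∈ B) {D : ℝ} (hD : 0 < D)
    (hdisp : ∀ p : C × Z, p.2 ∈ A → dist (h p).1 p.1 ≤ D) : A.card ≤ B.card := by
  obtain ⟨F, hF, hfin, hle⟩ := hC (1 + 1 / (B.card + 1)) (by simp; positivity) D hD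
  have hmaps : (F ×ˢ A).card ≤ (hfin.toFinset ×ˢ B).card := by
    refine Finset.card_le_card_of_injOn h (fun p hp => ?_) hinj.injOn
    obtain ⟨h1, h2⟩ := Finset.mem_product.1 hp
    exact Finset.mem_product.2
      ⟨hfin.mem_toFinset.2 ⟨p.1, h1, hdisp p h2⟩, hAB p h2⟩
  rw [Finset.card_product, Finset.card_product, ← Set.ncard_eq_toFinset_card _ hfin] at hmaps
  have hF0 : (0 : ℝ) < F.card := by exact_mod_cast hF.card_pos
  have hB : (0 : ℝ) < (B.card : ℝ) + 1 := by positivity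
  have h1 : (F.card : ℝ) * A.card ≤ F.card * ((1 + 1 / (B.card + 1)) * B.card) := by
    calc (F.card : ℝ) * A.card ≤ ({x : C | ∃ y ∈ F, dist x y ≤ D}.ncard : ℝ) * B.card := by
          exact_mod_cast hmaps
      _ ≤ (1 + 1 / (B.card + 1)) * F.card * B.card := by gcongr
      _ = _ := by ring
  have h2 := le_of_mul_le_mul_left h1 hF0
  have h3 : (1 + 1 / ((B.card : ℝ) + 1)) * B.card < B.card + 1 := by
    have : (B.card : ℝ) / (B.card + 1) < 1 := (div_lt_one hB).2 (by linarith)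
    calc (1 + 1 / ((B.card : ℝ) + 1)) * B.card = B.card + B.card / (B.card + 1) := by ring
      _ < _ := by linarith
  have h4 : (A.card : ℝ) < (B.card + 1 : ℕ) := by push_cast; linarith
  exact Nat.lt_succ_iff.1 (by exact_mod_cast h4)

section Fibers

variable {C Z X : Type*} [MetricSpace C] [MetricSpace Z] [MetricSpace X] {ε : ℝ≥0∞}

/-- The `Z`-coordinates of points sent to a given `ε`-component form a finite set. -/
theorem finite_setOf_mem_comp (hZultra : ∀ x y z : Z, dist x z ≤ max (dist x y) (dist y z))
    (hZb : BoundedlyFinite Z) (f : C × Z ≃ X) (hf' : CoarseMapM ⇑f.symm) (hε : ε ≠ ⊤)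
    (c : C) (x : X) : {z | f (c, z) ∈ comp X ε x}.Finite := by
  refine (hZb (Metric.closedBall (f.symm x).2 (osc ⇑f.symm ε).toReal)
    Metric.isBounded_closedBall).subset fun z hz => ?_
  have h : (f.symm (f (c, z))).2 ∈ comp Z (osc ⇑f.symm ε) (f.symm x).2 :=
    map_mem_comp (f := fun y => (f.symm y).2)
      (fun a b hab => (le_max_right _ _).trans (edist_map_le_osc f.symm hab)) hz
  have h' := edist_le_of_mem_comp hZultra h
  rw [f.symm_apply_apply] at h'
  rw [Metric.mem_closedBall, dist_comm, dist_edist]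
  exact ENNReal.toReal_mono (hf' ε hε) h'

theorem ncard_setOf_mem_comp_le (hCa : AmenableSpace C) (hX : ShiftHomogeneous X)
    (f : C × Z ≃ X) (hf' : CoarseMapM ⇑f.symm) (hε : ε ≠ ⊤) (c₀ : C)
    (hfib : ∀ (c : C) (z : Z), comp X ε (f (c, z)) = comp X ε (f (c₀, z)))
    (hfin : ∀ x : X, {z | f (c₀, z) ∈ comp X ε x}.Finite) (x y : X) :
    {z | f (c₀, z) ∈ comp X ε x}.ncard ≤ {z | f (c₀, z) ∈ comp X ε y}.ncard := by
  obtain ⟨g, rfl, hg⟩ := hX x y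
  obtain ⟨M, hM⟩ := hg _ (isLSCSet_comp hε x)
  have hmem : ∀ (p : C × Z) (w : X), f (c₀, p.2) ∈ comp X ε w ↔ f p ∈ comp X ε w := fun p w => by
    rw [← comp_eq_comp_iff, ← comp_eq_comp_iff, ← hfib p.1 p.2]
  set d := osc ⇑f.symm (ENNReal.ofReal M) with hd
  have hd' : d ≠ ⊤ := hf' _ ENNReal.ofReal_ne_top
  rw [Set.ncard_eq_toFinset_card _ (hfin x), Set.ncard_eq_toFinset_card _ (hfin (g x))]
  refine hCa.card_le_of_injective (h := fun p => f.symm (g (f p))) (D := d.toReal + 1)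
    (f.symm.injective.comp (g.injective.comp f.injective)) (fun p hp => ?_) (by positivity)
    fun p hp => ?_
  · rw [Set.Finite.mem_toFinset, Set.mem_ofPred_eq, hmem] at hp ⊢
    rw [f.apply_symm_apply]
    exact map_mem_comp (f := g) (fun a b hab => by rwa [g.edist_eq]) hp
  · rw [Set.Finite.mem_toFinset, Set.mem_ofPred_eq, hmem] at hp
    have h1 : edist (g (f p)) (f p) ≤ ENNReal.ofReal M := by
      rw [edist_dist]
      exact ENNReal.ofReal_le_ofReal (hM _ hp)
    have h2 : edist (f.symm (g (f p))).1 p.1 ≤ d := by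
      have := edist_map_le_osc f.symm h1
      rw [f.symm_apply_apply] at this
      exact (le_max_left _ _).trans this
    rw [dist_edist]
    exact (ENNReal.toReal_mono hd' h2).trans (by linarith)

end Fibers

/-- Lemma 7.5: if `Z` is a boundedly-finite ultrametric space, `C` an `s`-connected amenable
metric space (`s > 0`) and `f : C × Z → X` a coarse isomorphism onto a shift-homogeneous
space `X`, then `ω_f(s) ∈ ss(X)` and for each finite `ε ≥ ω_f(s)` there are `n ∈ ℕ` and an
`n`-to-1 map `f_ε : Z → X/ε` with `q_ε ∘ f = f_ε ∘ pr`. -/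
theorem fibered_factorization_lemma
    (C Z X : Type*) [MetricSpace C] [MetricSpace Z] [MetricSpace X]
    (hZultra : ∀ x y z : Z, dist x z ≤ max (dist x y) (dist y z))
    (hZb : BoundedlyFinite Z)
    (s : ℝ) (hs : 0 < s) (hC : ∀ x y : C, y ∈ comp C (ENNReal.ofReal s) x)
    (hCa : AmenableSpace C) (hX : ShiftHomogeneous X)
    (f : C × Z ≃ X) (hf : CoarseMapM ⇑f) (hf' : CoarseMapM ⇑f.symm) :
    osc ⇑f (ENNReal.ofReal s) ∈ ssSet X ∧
    ∀ ε : ℝ≥0∞, ε ≠ ⊤ → osc ⇑f (ENNReal.ofReal s) ≤ ε →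
      ∃ n : ℕ, 0 < n ∧ ∃ fε : Z → Set X,
        (∀ z : Z, ∃ x : X, fε z = comp X ε x) ∧
        (∀ (c : C) (z : Z), comp X ε (f (c, z)) = fε z) ∧
        ∀ x : X, (fε ⁻¹' {comp X ε x}).Finite ∧ (fε ⁻¹' {comp X ε x}).ncard = n := by
  obtain ⟨F, ⟨c₀, -⟩, -⟩ := hCa 2 one_lt_two 1 one_pos
  have hfib : ∀ ε : ℝ≥0∞, osc ⇑f (ENNReal.ofReal s) ≤ ε → ∀ (c : C) (z : Z),
      comp X ε (f (c, z)) = comp X ε (f (c₀, z)) := fun ε hε c z =>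
    comp_eq_comp_iff.2 <| map_mem_comp (f := fun c => f (c, z))
      (fun a b hab => (edist_map_le_osc f (by simpa [Prod.edist_eq] using hab)).trans hε) (hC c₀ c)
  have hfin : ∀ ε : ℝ≥0∞, ε ≠ ⊤ → ∀ x : X, {z | f (c₀, z) ∈ comp X ε x}.Finite :=
    fun ε hε x => finite_setOf_mem_comp hZultra hZb f hf' hε c₀ x
  refine ⟨fun δ hδ hle x => ?_, fun ε hε hle => ?_⟩
  · refine ((hfin δ hδ x).image fun z => comp X (osc ⇑f (ENNReal.ofReal s)) (f (c₀, z))).subset ?_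
    rintro _ ⟨y, hy, rfl⟩
    obtain ⟨⟨c, z⟩, rfl⟩ := f.surjective y
    refine ⟨z, ?_, (hfib _ le_rfl c z).symm⟩
    rw [Set.mem_ofPred_eq, ← comp_eq_comp_iff, ← hfib δ hle c z]
    exact comp_eq_comp_iff.2 hy
  · have hpre : ∀ x : X, (fun z => comp X ε (f (c₀, z))) ⁻¹' {comp X ε x} =
        {z | f (c₀, z) ∈ comp X ε x} := fun x => Set.ext fun z => comp_eq_comp_iff
    have hcard := ncard_setOf_mem_comp_le hCa hX f hf' hε c₀ (hfib ε hle) (hfin ε hε)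
    rcases isEmpty_or_nonempty Z with hZ | ⟨⟨z₀⟩⟩
    · exact ⟨1, one_pos, fun z => comp X ε (f (c₀, z)), fun z => ⟨_, rfl⟩, hfib ε hle,
        fun x => isEmptyElim (f.symm x).2⟩
    · refine ⟨{z | f (c₀, z) ∈ comp X ε (f (c₀, z₀))}.ncard,
        (Set.ncard_pos (hfin ε hε _)).2 ⟨z₀, mem_comp_self _⟩,
        fun z => comp X ε (f (c₀, z)), fun z => ⟨_, rfl⟩, hfib ε hle, fun x => ?_⟩
      rw [hpre x]
      exact ⟨hfin ε hε x, (hcard _ _).antisymm (hcard _ _)⟩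

end
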